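/- Let k be a field, let R1 and R2 be commutative k-algebras, let M1, N1 be R1-modules and M2, N2 be R2-modules. Then for every n ≥ 0 there is an isomorphism of k-vector spaces Tor_n^{R1 ⊗_k R2}(M1 ⊗_k M2, N1 ⊗_k N2) ≅ ⊕_{p+q=n} Tor_p^{R1}(M1, N1) ⊗_k Tor_q^{R2}(M2, N2). -/

import Mathlib

open TensorProduct CategoryTheory

section TensorModule

variable (k : Type) [CommRing k] (R1 R2 : Type) [CommRing R1] [CommRing R2]
  [Algebra k R1] [Algebra k R2]
variable (M1 M2 : Type) [AddCommGroup M1] [Module k M1] [Module R1 M1] [IsScalarTower k R1 M1]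
  [AddCommGroup M2] [Module k M2] [Module R2 M2] [IsScalarTower k R2 M2]

/-- The action of `R2` on `M1 ⊗[k] M2` through the right factor, as an algebra morphism
to endomorphisms. -/
noncomputable def rightSMul : R2 →ₐ[k] Module.End k (M1 ⊗[k] M2) :=
  ((Module.endTensorEndAlgHom (R := k) (S := k) (A := k) (M := M1) (N := M2)).comp
      (Algebra.TensorProduct.includeRight (R := k) (A := Module.End k M1))).comp
    (Algebra.lsmul k k M2 (A := R2))

/-- The `R2`-module structure on `M1 ⊗[k] M2` via the right factor. -/
noncomputable def rightModule : Module R2 (M1 ⊗[k] M2) :=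
  Module.compHom _ (rightSMul k R2 M1 M2).toRingHom

/-- The `R1 ⊗[k] R2`-module structure on `M1 ⊗[k] M2`, characterized by
`(r1 ⊗ r2) • (m1 ⊗ m2) = (r1 • m1) ⊗ (r2 • m2)`; see `tensorModule_smul_tmul`. -/
noncomputable instance (priority := 10) tensorModule :
    Module (R1 ⊗[k] R2) (M1 ⊗[k] M2) :=
  letI m2 : Module R2 (M1 ⊗[k] M2) := rightModule k R2 M1 M2
  haveI t2 : IsScalarTower k R2 (M1 ⊗[k] M2) := by
    refine IsScalarTower.of_algebraMap_smul (fun r x => ?_)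
    show (rightSMul k R2 M1 M2) (algebraMap k R2 r) x = r • x
    rw [AlgHom.commutes]
    simp [Module.algebraMap_end_apply]
  haveI sc : SMulCommClass R1 R2 (M1 ⊗[k] M2) := by
    constructor
    intro r1 r2 x
    show r1 • (rightSMul k R2 M1 M2 r2) x = (rightSMul k R2 M1 M2 r2) (r1 • x)
    induction x using TensorProduct.induction_on with
    | zero => simp
    | tmul m n =>
        have h1 : (rightSMul k R2 M1 M2 r2) (m ⊗ₜ[k] n) = m ⊗ₜ[k] (r2 • n) := rfl
        have h2 : (rightSMul k R2 M1 M2 r2) ((r1 • m) ⊗ₜ[k] n) = (r1 • m) ⊗ₜ[k] (r2 • n) := rfl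
        rw [h1, smul_tmul', smul_tmul', h2]
    | add x y hx hy =>
        calc r1 • (rightSMul k R2 M1 M2 r2) (x + y)
            = r1 • ((rightSMul k R2 M1 M2 r2) x + (rightSMul k R2 M1 M2 r2) y) := by
              rw [(rightSMul k R2 M1 M2 r2).map_add]
          _ = r1 • (rightSMul k R2 M1 M2 r2) x + r1 • (rightSMul k R2 M1 M2 r2) y :=
              smul_add _ _ _
          _ = (rightSMul k R2 M1 M2 r2) (r1 • x) + (rightSMul k R2 M1 M2 r2) (r1 • y) := by
              rw [hx, hy]
          _ = (rightSMul k R2 M1 M2 r2) (r1 • x + r1 • y) :=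
              ((rightSMul k R2 M1 M2 r2).map_add _ _).symm
          _ = (rightSMul k R2 M1 M2 r2) (r1 • (x + y)) := by rw [smul_add]
  TensorProduct.Algebra.module

/-- The defining property of the `R1 ⊗[k] R2`-module structure on `M1 ⊗[k] M2`. -/
lemma tensorModule_smul_tmul (r1 : R1) (r2 : R2) (m : M1) (n : M2) :
    (r1 ⊗ₜ[k] r2 : R1 ⊗[k] R2) • (m ⊗ₜ[k] n : M1 ⊗[k] M2) = (r1 • m) ⊗ₜ[k] (r2 • n) := rfl

end TensorModule

section HomAlg

variable (R : Type) [CommRing R]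

/-- The `i`-th Ext group `Ext_R^i(M, N)`. -/
noncomputable def extGroup (M N : Type) [AddCommGroup M] [Module R M]
    [AddCommGroup N] [Module R N] (i : ℕ) : Type :=
  (((Ext R (ModuleCat R) i).obj (Opposite.op (ModuleCat.of R M))).obj (ModuleCat.of R N) :
    ModuleCat R)

/-- The `i`-th Tor group `Tor_i^R(M, N)`. -/
noncomputable def torGroup (M N : Type) [AddCommGroup M] [Module R M]
    [AddCommGroup N] [Module R N] (i : ℕ) : Type :=
  (((Tor (ModuleCat R) i).obj (ModuleCat.of R M)).obj (ModuleCat.of R N) : ModuleCat R)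

/-- `C` is a semidualizing `R`-module: it is finitely generated, the homothety map
`R → Hom_R(C,C)`, `r ↦ (x ↦ r • x)`, is bijective, and `Ext_R^i(C,C) = 0` for all `i > 0`. -/
noncomputable def IsSemidualizing (C : Type) [AddCommGroup C] [Module R C] : Prop :=
  Module.Finite R C ∧
  Function.Bijective (LinearMap.lsmul R C) ∧
  ∀ i : ℕ, 0 < i → Subsingleton (extGroup R C C i)

end HomAlg

noncomputable instance torGroupAddCommGroup (R : Type) [CommRing R] (M N : Type)
    [AddCommGroup M] [Module R M] [AddCommGroup N] [Module R N] (i : ℕ) :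
    AddCommGroup (torGroup R M N i) :=
  inferInstanceAs (AddCommGroup
    (((Tor (ModuleCat R) i).obj (ModuleCat.of R M)).obj (ModuleCat.of R N) : ModuleCat R))

noncomputable instance torGroupModule (R : Type) [CommRing R] (M N : Type)
    [AddCommGroup M] [Module R M] [AddCommGroup N] [Module R N] (i : ℕ) :
    Module R (torGroup R M N i) :=
  inferInstanceAs (Module R
    (((Tor (ModuleCat R) i).obj (ModuleCat.of R M)).obj (ModuleCat.of R N) : ModuleCat R))

open Limits in
/-- The homology of a chain complex, as a complex with zero differentials. -/
noncomputable def ChainComplex.homologyComplex {C : Type*} [Category* C] [Abelian C]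
    (K : ChainComplex C ℕ) : ChainComplex C ℕ where
  X n := K.homology n
  d _ _ := 0

theorem ChainComplex.nonempty_homotopyEquiv_homologyComplex {C : Type*} [Category* C] [Abelian C]
    [∀ X : C, Projective X] (K : ChainComplex C ℕ) :
    Nonempty (HomotopyEquiv K K.homologyComplex) := by
  have hσ (n : ℕ) : ∃ σ : K.homology n ⟶ K.cycles n, σ ≫ K.homologyπ n = 𝟙 _ :=
    ⟨Projective.factorThru (𝟙 _) (K.homologyπ n), by simp⟩
  choose σ hσ using hσ
  have hu (n : ℕ) : ∃ u : K.cycles n ⟶ K.X (n + 1),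
      u ≫ K.toCycles (n + 1) n = 𝟙 _ - K.homologyπ n ≫ σ n := by
    let S : ShortComplex C := ShortComplex.mk (K.toCycles (n + 1) n) (K.homologyπ n) (by simp)
    have hS : S.Exact := ShortComplex.exact_of_g_is_cokernel _
      (K.homologyIsCokernel (n + 1) n (by simp))
    exact ⟨hS.liftFromProjective (𝟙 _ - K.homologyπ n ≫ σ n) (by simp [S, hσ]),
      hS.liftFromProjective_comp _ _⟩
  choose u hu using hu
  have hr (n : ℕ) : ∃ r : K.X n ⟶ K.cycles n, K.iCycles n ≫ r = 𝟙 _ ∧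
      (n = 0 → r ≫ K.iCycles n = 𝟙 _) ∧
      ∀ m (h : n = m + 1), r ≫ K.iCycles n =
        𝟙 _ - K.toCycles n m ≫ u m ≫ (K.XIsoOfEq h).inv := by
    obtain _ | m := n
    · refine ⟨K.liftCycles (𝟙 _) 0 (by simp) (by simp), ?_, ?_, ?_⟩
      · simp [← cancel_mono (K.iCycles 0)]
      · simp
      · simp
    · have h1 : K.toCycles (m + 1) m ≫ u m ≫ K.toCycles (m + 1) m = K.toCycles (m + 1) m := by
        simp [hu]
      have h2 : K.toCycles (m + 1) m ≫ u m ≫ K.d (m + 1) m = K.d (m + 1) m := by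
        simpa using congr($h1 ≫ K.iCycles m)
      have h3 : K.iCycles (m + 1) ≫ K.toCycles (m + 1) m = 0 := by
        simp [← cancel_mono (K.iCycles m)]
      refine ⟨K.liftCycles (𝟙 _ - K.toCycles (m + 1) m ≫ u m) m (by simp) (by simp [h2]),
        ?_, ?_, ?_⟩
      · simp [← cancel_mono (K.iCycles (m + 1)), reassoc_of% h3]
      · simp
      · rintro m' h
        obtain rfl : m = m' := by omega
        simp [HomologicalComplex.XIsoOfEq]
  choose r hr hr0 hrs using hr
  have h3 (m : ℕ) : K.d (m + 1) m ≫ r m = K.toCycles (m + 1) m := by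
    rw [← K.toCycles_i, Category.assoc, hr, Category.comp_id]
  let f : K ⟶ K.homologyComplex :=
    { f n := r n ≫ K.homologyπ n
      comm' i j hij := by
        obtain rfl : j + 1 = i := hij
        simp [homologyComplex, reassoc_of% (h3 j)] }
  let g : K.homologyComplex ⟶ K :=
    { f n := σ n ≫ K.iCycles n
      comm' i j hij := by simp [homologyComplex] }
  have hgf : g ≫ f = 𝟙 _ := by
    ext n
    change (σ n ≫ K.iCycles n) ≫ r n ≫ K.homologyπ n = 𝟙 (K.homology n)
    rw [Category.assoc, reassoc_of% (hr n), hσ]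
  let s (i j : ℕ) : K.X i ⟶ K.X j :=
    if h : i + 1 = j then r i ≫ u i ≫ (K.XIsoOfEq h).hom else 0
  have hs (i : ℕ) : s i (i + 1) = r i ≫ u i := by
    simp [s, HomologicalComplex.XIsoOfEq]
  refine ⟨⟨f, g, Homotopy.symm ⟨s, fun i j h ↦ dif_neg h, fun i ↦ ?_⟩, Homotopy.ofEq hgf⟩⟩
  have key : r i ≫ u i ≫ K.d (i + 1) i + (f ≫ g).f i = r i ≫ K.iCycles i := by
    have hfg : (f ≫ g).f i = r i ≫ K.homologyπ i ≫ σ i ≫ K.iCycles i := Category.assoc _ _ _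
    rw [← K.toCycles_i, reassoc_of% (hu i), hfg]
    simp
  rw [Homotopy.prevD_chainComplex, hs, add_assoc, Category.assoc, key]
  obtain _ | m := i
  · simp [hr0]
  · rw [Homotopy.dNext_succ_chainComplex, hs, hrs (m + 1) m rfl, reassoc_of% (h3 m)]
    simp [HomologicalComplex.XIsoOfEq]

open HomologicalComplex in
/-- A biadditive functor sends a pair of homotopy equivalences to a homotopy equivalence of total
complexes. -/
noncomputable def HomotopyEquiv.mapBifunctor {C₁ C₂ D I₁ I₂ J : Type*} [Category* C₁]
    [Category* C₂] [Category* D] [Preadditive C₁] [Preadditive C₂] [Preadditive D]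
    {c₁ : ComplexShape I₁} {c₂ : ComplexShape I₂}
    {K₁ L₁ : HomologicalComplex C₁ c₁} {K₂ L₂ : HomologicalComplex C₂ c₂}
    (e₁ : HomotopyEquiv K₁ L₁) (e₂ : HomotopyEquiv K₂ L₂)
    (F : C₁ ⥤ C₂ ⥤ D) [F.Additive] [∀ X₁, (F.obj X₁).Additive]
    (c : ComplexShape J) [DecidableEq J] [TotalComplexShape c₁ c₂ c]
    [HasMapBifunctor K₁ K₂ F c] [HasMapBifunctor L₁ L₂ F c] :
    HomotopyEquiv (HomologicalComplex.mapBifunctor K₁ K₂ F c)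
      (HomologicalComplex.mapBifunctor L₁ L₂ F c) where
  hom := mapBifunctorMap e₁.hom e₂.hom F c
  inv := mapBifunctorMap e₁.inv e₂.inv F c
  homotopyHomInvId := (Homotopy.ofEq (by ext; simp)).trans
    (((mapBifunctorMapHomotopy₁ e₁.homotopyHomInvId (e₂.hom ≫ e₂.inv) F c).trans
      (mapBifunctorMapHomotopy₂ (𝟙 _) e₂.homotopyHomInvId F c)).trans
        (Homotopy.ofEq (by ext; simp)))
  homotopyInvHomId := (Homotopy.ofEq (by ext; simp)).trans
    (((mapBifunctorMapHomotopy₁ e₁.homotopyInvHomId (e₂.inv ≫ e₂.hom) F c).trans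
      (mapBifunctorMapHomotopy₂ (𝟙 _) e₂.homotopyInvHomId F c)).trans
        (Homotopy.ofEq (by ext; simp)))

section TotalComplexComparison

open Limits HomologicalComplex

/-- Precomposing the injections of a coproduct with isomorphisms yields a coproduct. -/
noncomputable def isColimitCofanMkIsoComp {C T : Type*} [Category* C] {X Y : T → C} {P : C}
    (g : ∀ t, Y t ⟶ P) (e : ∀ t, X t ≅ Y t) (h : IsColimit (Cofan.mk P g)) :
    IsColimit (Cofan.mk P (fun t ↦ (e t).hom ≫ g t)) :=
  Cofan.IsColimit.mk _ (fun s ↦ Cofan.IsColimit.desc h (fun t ↦ (e t).inv ≫ s.inj t))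
    (fun s t ↦ by
      have := Cofan.IsColimit.fac h (fun t ↦ (e t).inv ≫ s.inj t) t
      simp only [Cofan.inj, Cofan.mk_ι_app] at this ⊢
      simp [this])
    (fun s m hm ↦ Cofan.IsColimit.hom_ext h _ _ (fun t ↦ by
      rw [Cofan.IsColimit.fac, ← hm]
      simp [Cofan.inj]))

variable {C₁ C₂ D C₁' C₂' D' : Type*} [Category* C₁] [Category* C₂] [Category* D]
  [Category* C₁'] [Category* C₂'] [Category* D'] [Preadditive C₁] [Preadditive C₂] [Preadditive D]
  [Preadditive C₁'] [Preadditive C₂'] [Preadditive D']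
  {I₁ I₂ J : Type} {c₁ : ComplexShape I₁} {c₂ : ComplexShape I₂}
  (K₁ : HomologicalComplex C₁ c₁) (K₂ : HomologicalComplex C₂ c₂)
  (F : C₁ ⥤ C₂ ⥤ D) [F.Additive] [∀ X₁, (F.obj X₁).Additive]
  (K₁' : HomologicalComplex C₁' c₁) (K₂' : HomologicalComplex C₂' c₂)
  (F' : C₁' ⥤ C₂' ⥤ D') [F'.Additive] [∀ X₁, (F'.obj X₁).Additive]
  (c : ComplexShape J) [DecidableEq J] [TotalComplexShape c₁ c₂ c]
  (G : D ⥤ D') [PreservesColimitsOfSize.{0, 0} G]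
  [HasMapBifunctor K₁ K₂ F c] [HasMapBifunctor K₁' K₂' F' c]
  (e : ∀ i j, (F'.obj (K₁'.X i)).obj (K₂'.X j) ≅ G.obj ((F.obj (K₁.X i)).obj (K₂.X j)))

/-- The cofan exhibiting the image under `G` of a term of a total complex as a coproduct. -/
noncomputable def mapBifunctorMapCofan (j : J) :
    GradedObject.CofanMapObjFun (((F'.mapBifunctorHomologicalComplex c₁ c₂).obj
      K₁').obj K₂').toGradedObject (ComplexShape.π c₁ c₂ c) j :=
  GradedObject.CofanMapObjFun.mk _ _ _ (G.obj ((mapBifunctor K₁ K₂ F c).X j))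
    (fun i hi ↦ (e i.1 i.2).hom ≫ G.map (ιMapBifunctor K₁ K₂ F c i.1 i.2 j hi))

/-- `mapBifunctorMapCofan` is a coproduct when `G` preserves coproducts. -/
noncomputable def isColimitMapBifunctorMapCofan (j : J) :
    IsColimit (mapBifunctorMapCofan K₁ K₂ F K₁' K₂' F' c G e j) :=
  isColimitCofanMkIsoComp _ (fun i : ComplexShape.π c₁ c₂ c ⁻¹' {j} ↦ e i.1.1 i.1.2)
    (isColimitCofanMkObjOfIsColimit G
      (fun i : ComplexShape.π c₁ c₂ c ⁻¹' {j} ↦ (F.obj (K₁.X i.1.1)).obj (K₂.X i.1.2))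
      (fun i ↦ ιMapBifunctor K₁ K₂ F c i.1.1 i.1.2 j i.2)
      (GradedObject.isColimitCofanMapObj (((F.mapBifunctorHomologicalComplex c₁ c₂).obj
        K₁).obj K₂).toGradedObject (ComplexShape.π c₁ c₂ c) j))

/-- The degreewise comparison between the total complexes of two bicomplexes which correspond to
each other under a functor `G` preserving coproducts. -/
noncomputable def mapBifunctorXIso (j : J) :
    (mapBifunctor K₁' K₂' F' c).X j ≅ G.obj ((mapBifunctor K₁ K₂ F c).X j) :=
  (GradedObject.CofanMapObjFun.iso
    (isColimitMapBifunctorMapCofan K₁ K₂ F K₁' K₂' F' c G e j)).symm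

lemma ι_mapBifunctorXIso_hom (i₁ : I₁) (i₂ : I₂) (j : J)
    (h : ComplexShape.π c₁ c₂ c (i₁, i₂) = j) :
    ιMapBifunctor K₁' K₂' F' c i₁ i₂ j h ≫
        (mapBifunctorXIso K₁ K₂ F K₁' K₂' F' c G e j).hom =
      (e i₁ i₂).hom ≫ G.map (ιMapBifunctor K₁ K₂ F c i₁ i₂ j h) :=
  GradedObject.CofanMapObjFun.ιMapObj_iso_inv
    (isColimitMapBifunctorMapCofan K₁ K₂ F K₁' K₂' F' c G e j) (i₁, i₂) h

lemma mapBifunctorXIso_hom_comm [G.Additive]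
    (he₁ : ∀ i i' j, (F'.map (K₁'.d i i')).app (K₂'.X j) ≫ (e i' j).hom =
        (e i j).hom ≫ G.map ((F.map (K₁.d i i')).app (K₂.X j)))
    (he₂ : ∀ i j j', (F'.obj (K₁'.X i)).map (K₂'.d j j') ≫ (e i j').hom =
        (e i j).hom ≫ G.map ((F.obj (K₁.X i)).map (K₂.d j j')))
    (j j' : J) :
    (mapBifunctorXIso K₁ K₂ F K₁' K₂' F' c G e j).hom ≫ G.map ((mapBifunctor K₁ K₂ F c).d j j') =
      (mapBifunctor K₁' K₂' F' c).d j j' ≫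
        (mapBifunctorXIso K₁ K₂ F K₁' K₂' F' c G e j').hom := by
  apply mapBifunctor.hom_ext
  intro i₁ i₂ h
  rw [reassoc_of% (ι_mapBifunctorXIso_hom K₁ K₂ F K₁' K₂' F' c G e), mapBifunctor.d_eq,
    mapBifunctor.d_eq, ← G.map_comp,
    Preadditive.comp_add, Preadditive.add_comp, Preadditive.comp_add, G.map_add,
    Preadditive.comp_add]
  simp only [mapBifunctor.ι_D₁, mapBifunctor.ι_D₂, mapBifunctor.ι_D₁_assoc,
    mapBifunctor.ι_D₂_assoc]
  congr 1
  · by_cases h₁ : c₁.Rel i₁ (c₁.next i₁)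
    · by_cases h₂ : ComplexShape.π c₁ c₂ c (c₁.next i₁, i₂) = j'
      · rw [mapBifunctor.d₁_eq _ _ _ _ h₁ _ _ h₂, mapBifunctor.d₁_eq _ _ _ _ h₁ _ _ h₂]
        simp only [Functor.map_units_smul, Linear.comp_units_smul, Linear.units_smul_comp,
          Category.assoc, ι_mapBifunctorXIso_hom, Functor.map_comp]
        congr 1
        exact (reassoc_of% (he₁ i₁ (c₁.next i₁) i₂)) _ |>.symm
      · rw [mapBifunctor.d₁_eq_zero' _ _ _ _ h₁ _ _ h₂, mapBifunctor.d₁_eq_zero' _ _ _ _ h₁ _ _ h₂]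
        simp
    · rw [mapBifunctor.d₁_eq_zero _ _ _ _ _ _ _ h₁, mapBifunctor.d₁_eq_zero _ _ _ _ _ _ _ h₁]
      simp
  · by_cases h₁ : c₂.Rel i₂ (c₂.next i₂)
    · by_cases h₂ : ComplexShape.π c₁ c₂ c (i₁, c₂.next i₂) = j'
      · rw [mapBifunctor.d₂_eq _ _ _ _ _ h₁ _ h₂, mapBifunctor.d₂_eq _ _ _ _ _ h₁ _ h₂]
        simp only [Functor.map_units_smul, Linear.comp_units_smul, Linear.units_smul_comp,
          Category.assoc, ι_mapBifunctorXIso_hom, Functor.map_comp]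
        congr 1
        exact (reassoc_of% (he₂ i₁ i₂ (c₂.next i₂))) _ |>.symm
      · rw [mapBifunctor.d₂_eq_zero' _ _ _ _ _ h₁ _ h₂, mapBifunctor.d₂_eq_zero' _ _ _ _ _ h₁ _ h₂]
        simp
    · rw [mapBifunctor.d₂_eq_zero _ _ _ _ _ _ _ h₁, mapBifunctor.d₂_eq_zero _ _ _ _ _ _ _ h₁]
      simp

/-- The total complex of a biadditive functor is compatible with functors preserving coproducts. -/
noncomputable def mapBifunctorMapIso [G.Additive]
    (he₁ : ∀ i i' j, (F'.map (K₁'.d i i')).app (K₂'.X j) ≫ (e i' j).hom =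
        (e i j).hom ≫ G.map ((F.map (K₁.d i i')).app (K₂.X j)))
    (he₂ : ∀ i j j', (F'.obj (K₁'.X i)).map (K₂'.d j j') ≫ (e i j').hom =
        (e i j).hom ≫ G.map ((F.obj (K₁.X i)).map (K₂.d j j'))) :
    mapBifunctor K₁' K₂' F' c ≅ (G.mapHomologicalComplex c).obj (mapBifunctor K₁ K₂ F c) :=
  HomologicalComplex.Hom.isoOfComponents (mapBifunctorXIso K₁ K₂ F K₁' K₂' F' c G e)
    (fun j j' _ ↦ mapBifunctorXIso_hom_comm K₁ K₂ F K₁' K₂' F' c G e he₁ he₂ j j')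

end TotalComplexComparison

section TensorModuleMaps

variable (k : Type) [CommRing k] (R1 R2 : Type) [CommRing R1] [CommRing R2]
  [Algebra k R1] [Algebra k R2]
variable {M1 M2 N1 N2 P Q T1 T2 : Type}
  [AddCommGroup M1] [Module k M1] [Module R1 M1] [IsScalarTower k R1 M1]
  [AddCommGroup M2] [Module k M2] [Module R2 M2] [IsScalarTower k R2 M2]
  [AddCommGroup N1] [Module k N1] [Module R1 N1] [IsScalarTower k R1 N1]
  [AddCommGroup N2] [Module k N2] [Module R2 N2] [IsScalarTower k R2 N2]
  [AddCommGroup P] [Module k P] [Module R1 P] [IsScalarTower k R1 P]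
  [AddCommGroup Q] [Module k Q] [Module R2 Q] [IsScalarTower k R2 Q]
  [AddCommGroup T1] [Module k T1] [Module R1 T1] [IsScalarTower k R1 T1]
  [AddCommGroup T2] [Module k T2] [Module R2 T2] [IsScalarTower k R2 T2]

/-- An additive map out of `M1 ⊗[k] M2` which is compatible with the actions of pure tensors on
pure tensors is linear over `R1 ⊗[k] R2`. -/
def linearMapOfTmul {X : Type*} [AddCommGroup X] [Module (R1 ⊗[k] R2) X] (φ : M1 ⊗[k] M2 →+ X)
    (h : ∀ (r1 : R1) (r2 : R2) (m1 : M1) (m2 : M2),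
      φ ((r1 • m1) ⊗ₜ (r2 • m2)) = (r1 ⊗ₜ[k] r2) • φ (m1 ⊗ₜ m2)) :
    M1 ⊗[k] M2 →ₗ[R1 ⊗[k] R2] X where
  toFun := φ
  map_add' := φ.map_add
  map_smul' a x := by
    dsimp only [RingHom.id_apply]
    induction a using TensorProduct.induction_on with
    | zero => simp
    | add a b ha hb => rw [add_smul, map_add, ha, hb, add_smul]
    | tmul r1 r2 =>
      induction x using TensorProduct.induction_on with
      | zero => simp
      | add x y hx hy => rw [smul_add, map_add, hx, hy, map_add, smul_add]
      | tmul m1 m2 => rw [tensorModule_smul_tmul, h]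

/-- The tensor product over `k` of an `R1`-linear map and an `R2`-linear map, as an
`R1 ⊗[k] R2`-linear map. -/
noncomputable def tensorModuleMap (f : M1 →ₗ[R1] N1) (g : M2 →ₗ[R2] N2) :
    M1 ⊗[k] M2 →ₗ[R1 ⊗[k] R2] N1 ⊗[k] N2 :=
  linearMapOfTmul k R1 R2
    (TensorProduct.map (f.restrictScalars k) (g.restrictScalars k)).toAddMonoidHom
    (fun r1 r2 m1 m2 ↦ by simp [tensorModule_smul_tmul])

@[simp]
lemma tensorModuleMap_tmul (f : M1 →ₗ[R1] N1) (g : M2 →ₗ[R2] N2) (m1 : M1) (m2 : M2) :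
    tensorModuleMap k R1 R2 f g (m1 ⊗ₜ m2) = f m1 ⊗ₜ g m2 := rfl

variable {k R1 R2} in
lemma tensorModule_linearMap_ext {X : Type*} [AddCommGroup X] [Module (R1 ⊗[k] R2) X]
    {f g : M1 ⊗[k] M2 →ₗ[R1 ⊗[k] R2] X} (h : ∀ m1 m2, f (m1 ⊗ₜ m2) = g (m1 ⊗ₜ m2)) : f = g := by
  ext x
  induction x using TensorProduct.induction_on with
  | zero => simp
  | add x y hx hy => rw [map_add, map_add, hx, hy]
  | tmul m1 m2 => exact h m1 m2

variable (M2 Q) in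
/-- The map `m2 ⊗ q ↦ (m1 ⊗ m2) ⊗ (p ⊗ q)`. -/
noncomputable def tensorInterchangeRight (m1 : M1) (p : P) :
    M2 ⊗[R2] Q →+ (M1 ⊗[k] M2) ⊗[R1 ⊗[k] R2] (P ⊗[k] Q) :=
  TensorProduct.liftAddHom
    (AddMonoidHom.mk' (fun m2 : M2 ↦ AddMonoidHom.mk'
        (fun q : Q ↦ ((m1 ⊗ₜ[k] m2) ⊗ₜ[R1 ⊗[k] R2] (p ⊗ₜ[k] q) :
          (M1 ⊗[k] M2) ⊗[R1 ⊗[k] R2] (P ⊗[k] Q)))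
        (fun q q' ↦ by rw [tmul_add, tmul_add]))
      (fun m2 m2' ↦ by ext q; simp [tmul_add, add_tmul]))
    (fun r m2 q ↦ by
      have h1 : (m1 ⊗ₜ[k] (r • m2) : M1 ⊗[k] M2) = (1 ⊗ₜ[k] r : R1 ⊗[k] R2) • (m1 ⊗ₜ[k] m2) := by
        rw [tensorModule_smul_tmul, one_smul]
      have h2 : (p ⊗ₜ[k] (r • q) : P ⊗[k] Q) = (1 ⊗ₜ[k] r : R1 ⊗[k] R2) • (p ⊗ₜ[k] q) := by
        rw [tensorModule_smul_tmul, one_smul]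
      simp only [AddMonoidHom.mk'_apply]
      rw [h1, h2, TensorProduct.smul_tmul])

@[simp]
lemma tensorInterchangeRight_tmul (m1 : M1) (m2 : M2) (p : P) (q : Q) :
    tensorInterchangeRight k R1 R2 M2 Q m1 p (m2 ⊗ₜ q) = (m1 ⊗ₜ m2) ⊗ₜ (p ⊗ₜ q) := rfl

lemma TensorProduct.addMonoidHom_ext {R M N X : Type*} [CommSemiring R] [AddCommMonoid M]
    [AddCommMonoid N] [Module R M] [Module R N] [AddCommMonoid X] {f g : M ⊗[R] N →+ X}
    (h : ∀ m n, f (m ⊗ₜ n) = g (m ⊗ₜ n)) : f = g := by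
  refine DFunLike.ext _ _ (fun x ↦ ?_)
  induction x using TensorProduct.induction_on with
  | zero => rw [map_zero, map_zero]
  | add x y hx hy => rw [map_add, map_add, hx, hy]
  | tmul m n => exact h m n

variable (M1 M2 P Q) in
/-- The canonical map `(M1 ⊗[R1] P) × (M2 ⊗[R2] Q) → (M1 ⊗[k] M2) ⊗[R1 ⊗[k] R2] (P ⊗[k] Q)`. -/
noncomputable def tensorInterchange :
    M1 ⊗[R1] P →+ M2 ⊗[R2] Q →+ (M1 ⊗[k] M2) ⊗[R1 ⊗[k] R2] (P ⊗[k] Q) :=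
  TensorProduct.liftAddHom
    (AddMonoidHom.mk' (fun m1 : M1 ↦ AddMonoidHom.mk'
        (fun p : P ↦ tensorInterchangeRight k R1 R2 M2 Q m1 p)
        (fun p p' ↦ TensorProduct.addMonoidHom_ext (fun m2 q ↦ by simp [add_tmul, tmul_add])))
      (fun m m' ↦ DFunLike.ext _ _ (fun p ↦ TensorProduct.addMonoidHom_ext (fun m2 q ↦ by
        simp [add_tmul]))))
    (fun r m1 p ↦ TensorProduct.addMonoidHom_ext (fun m2 q ↦ by
      have h1 : ((r • m1) ⊗ₜ[k] m2 : M1 ⊗[k] M2) = (r ⊗ₜ[k] 1 : R1 ⊗[k] R2) • (m1 ⊗ₜ[k] m2) := by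
        rw [tensorModule_smul_tmul, one_smul]
      have h2 : ((r • p) ⊗ₜ[k] q : P ⊗[k] Q) = (r ⊗ₜ[k] 1 : R1 ⊗[k] R2) • (p ⊗ₜ[k] q) := by
        rw [tensorModule_smul_tmul, one_smul]
      simp only [AddMonoidHom.mk'_apply, tensorInterchangeRight_tmul]
      rw [h1, h2, TensorProduct.smul_tmul]))

@[simp]
lemma tensorInterchange_tmul_tmul (m1 : M1) (m2 : M2) (p : P) (q : Q) :
    tensorInterchange k R1 R2 M1 M2 P Q (m1 ⊗ₜ p) (m2 ⊗ₜ q) = (m1 ⊗ₜ m2) ⊗ₜ (p ⊗ₜ q) := rfl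

lemma tensorInterchange_smul_smul (r1 : R1) (r2 : R2) (x : M1 ⊗[R1] P) (y : M2 ⊗[R2] Q) :
    tensorInterchange k R1 R2 M1 M2 P Q (r1 • x) (r2 • y) =
      (r1 ⊗ₜ[k] r2) • tensorInterchange k R1 R2 M1 M2 P Q x y := by
  induction x using TensorProduct.induction_on with
  | zero => simp
  | add x x' hx hx' =>
    rw [smul_add, map_add, AddMonoidHom.add_apply, hx, hx', map_add, AddMonoidHom.add_apply,
      smul_add]
  | tmul m1 p =>
    induction y using TensorProduct.induction_on with
    | zero => simp
    | add y y' hy hy' => rw [smul_add, map_add, hy, hy', map_add, smul_add]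
    | tmul m2 q =>
      rw [TensorProduct.smul_tmul', TensorProduct.smul_tmul', tensorInterchange_tmul_tmul,
        tensorInterchange_tmul_tmul, TensorProduct.smul_tmul', tensorModule_smul_tmul]

/-- The map `(M1 ⊗[k] M2) ⊗[R1 ⊗[k] R2] (P ⊗[k] Q) → (M1 ⊗[R1] P) ⊗[k] (M2 ⊗[R2] Q)`. -/
noncomputable def tensorDistribHom (e1 : M1 ⊗[R1] P ≃ₗ[R1] T1) (e2 : M2 ⊗[R2] Q ≃ₗ[R2] T2) :
    (M1 ⊗[k] M2) ⊗[R1 ⊗[k] R2] (P ⊗[k] Q) →ₗ[R1 ⊗[k] R2] T1 ⊗[k] T2 :=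
  TensorProduct.lift (linearMapOfTmul k R1 R2
    (TensorProduct.liftAddHom
      (AddMonoidHom.mk' (fun m1 ↦ AddMonoidHom.mk' (fun m2 ↦
        tensorModuleMap k R1 R2 (e1.toLinearMap ∘ₗ TensorProduct.mk R1 M1 P m1)
          (e2.toLinearMap ∘ₗ TensorProduct.mk R2 M2 Q m2))
        (fun x y ↦ tensorModule_linearMap_ext (by simp [tmul_add])))
        (fun x y ↦ by
          ext m2 : 1
          exact tensorModule_linearMap_ext (by simp [add_tmul])))
      (fun c m1 m2 ↦ tensorModule_linearMap_ext (fun p q ↦ by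
        simp only [AddMonoidHom.mk'_apply, tensorModuleMap_tmul, LinearMap.comp_apply,
          TensorProduct.mk_apply, LinearEquiv.coe_coe]
        rw [← algebraMap_smul R1 c m1, ← algebraMap_smul R2 c m2, ← TensorProduct.smul_tmul',
          ← TensorProduct.smul_tmul', map_smul, map_smul, algebraMap_smul, algebraMap_smul,
          TensorProduct.smul_tmul])))
    (fun r1 r2 m1 m2 ↦ tensorModule_linearMap_ext (fun p q ↦ by
        simp only [AddMonoidHom.mk'_apply, tensorModuleMap_tmul, LinearMap.comp_apply,
          TensorProduct.mk_apply, LinearEquiv.coe_coe, TensorProduct.liftAddHom_tmul,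
          LinearMap.smul_apply, tensorModule_smul_tmul]
        rw [← TensorProduct.smul_tmul', ← TensorProduct.smul_tmul', map_smul, map_smul])))

@[simp]
lemma tensorDistribHom_tmul (e1 : M1 ⊗[R1] P ≃ₗ[R1] T1) (e2 : M2 ⊗[R2] Q ≃ₗ[R2] T2)
    (m1 : M1) (m2 : M2) (p : P) (q : Q) :
    tensorDistribHom k R1 R2 e1 e2 ((m1 ⊗ₜ m2) ⊗ₜ (p ⊗ₜ q)) =
      e1 (m1 ⊗ₜ p) ⊗ₜ e2 (m2 ⊗ₜ q) := rfl

/-- The inverse of `tensorDistribHom`. -/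
noncomputable def tensorDistribInv (e1 : M1 ⊗[R1] P ≃ₗ[R1] T1) (e2 : M2 ⊗[R2] Q ≃ₗ[R2] T2) :
    T1 ⊗[k] T2 →ₗ[R1 ⊗[k] R2] (M1 ⊗[k] M2) ⊗[R1 ⊗[k] R2] (P ⊗[k] Q) :=
  linearMapOfTmul k R1 R2
    (TensorProduct.liftAddHom
      (AddMonoidHom.mk' (fun x ↦ (tensorInterchange k R1 R2 M1 M2 P Q (e1.symm x)).comp
        e2.symm.toLinearMap.toAddMonoidHom) (fun x y ↦ by ext; simp))
      (fun c x y ↦ by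
        simp only [AddMonoidHom.mk'_apply, AddMonoidHom.comp_apply, LinearMap.toAddMonoidHom_coe,
          LinearEquiv.coe_coe]
        rw [← algebraMap_smul R1 c x, ← algebraMap_smul R2 c y, e1.symm.map_smul,
          e2.symm.map_smul]
        have h1 := tensorInterchange_smul_smul k R1 R2 (algebraMap k R1 c) 1 (e1.symm x) (e2.symm y)
        have h2 := tensorInterchange_smul_smul k R1 R2 1 (algebraMap k R2 c) (e1.symm x) (e2.symm y)
        rw [one_smul] at h1 h2
        rw [h1, h2, Algebra.algebraMap_eq_smul_one, Algebra.algebraMap_eq_smul_one,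
          TensorProduct.smul_tmul]))
    (fun r1 r2 x y ↦ by
      simp [tensorInterchange_smul_smul])

@[simp]
lemma tensorDistribInv_tmul (e1 : M1 ⊗[R1] P ≃ₗ[R1] T1) (e2 : M2 ⊗[R2] Q ≃ₗ[R2] T2)
    (x : T1) (y : T2) :
    tensorDistribInv k R1 R2 e1 e2 (x ⊗ₜ y) =
      tensorInterchange k R1 R2 M1 M2 P Q (e1.symm x) (e2.symm y) := rfl

/-- The isomorphism `(M1 ⊗[k] M2) ⊗[R1 ⊗[k] R2] (P ⊗[k] Q) ≃ (M1 ⊗[R1] P) ⊗[k] (M2 ⊗[R2] Q)`. -/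
noncomputable def tensorDistrib (e1 : M1 ⊗[R1] P ≃ₗ[R1] T1) (e2 : M2 ⊗[R2] Q ≃ₗ[R2] T2) :
    (M1 ⊗[k] M2) ⊗[R1 ⊗[k] R2] (P ⊗[k] Q) ≃ₗ[R1 ⊗[k] R2] T1 ⊗[k] T2 :=
  LinearEquiv.ofLinearMap (tensorDistribHom k R1 R2 e1 e2) (tensorDistribInv k R1 R2 e1 e2)
    (tensorModule_linearMap_ext (fun x y ↦ by
      obtain ⟨x, rfl⟩ := e1.surjective x
      obtain ⟨y, rfl⟩ := e2.surjective y
      simp only [LinearMap.comp_apply, tensorDistribInv_tmul, LinearEquiv.symm_apply_apply,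
        LinearMap.id_apply]
      induction x using TensorProduct.induction_on with
      | zero => simp
      | add x x' hx hx' => simp only [map_add, AddMonoidHom.add_apply, hx, hx', add_tmul]
      | tmul m1 p =>
        induction y using TensorProduct.induction_on with
        | zero => simp
        | add y y' hy hy' => simp only [map_add, hy, hy', tmul_add]
        | tmul m2 q => simp))
    (TensorProduct.ext (tensorModule_linearMap_ext (fun m1 m2 ↦
      tensorModule_linearMap_ext (fun p q ↦ by simp))))

end TensorModuleMaps

section FieldKunneth

open Limits HomologicalComplex MonoidalCategory

theorem mapBifunctor_d_eq_zero {C₁ C₂ D I₁ I₂ J : Type*} [Category* C₁]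
    [Category* C₂] [Category* D] [Preadditive C₁] [Preadditive C₂] [Preadditive D]
    {c₁ : ComplexShape I₁} {c₂ : ComplexShape I₂}
    (K₁ : HomologicalComplex C₁ c₁) (K₂ : HomologicalComplex C₂ c₂)
    (F : C₁ ⥤ C₂ ⥤ D) [F.Additive] [∀ X₁, (F.obj X₁).Additive]
    (c : ComplexShape J) [DecidableEq J] [TotalComplexShape c₁ c₂ c]
    [HasMapBifunctor K₁ K₂ F c] (h₁ : ∀ i j, K₁.d i j = 0) (h₂ : ∀ i j, K₂.d i j = 0) (i j : J) :
    (mapBifunctor K₁ K₂ F c).d i j = 0 := by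
  apply mapBifunctor.hom_ext
  intro i₁ i₂ h
  rw [mapBifunctor.d_eq, Preadditive.comp_add, mapBifunctor.ι_D₁, mapBifunctor.ι_D₂, comp_zero]
  have e₁ : mapBifunctor.d₁ K₁ K₂ F c i₁ i₂ j = 0 := by
    by_cases h₃ : c₁.Rel i₁ (c₁.next i₁)
    · rw [mapBifunctor.d₁_eq' _ _ _ _ h₃]
      simp [h₁]
    · exact mapBifunctor.d₁_eq_zero _ _ _ _ _ _ _ h₃
  have e₂ : mapBifunctor.d₂ K₁ K₂ F c i₁ i₂ j = 0 := by
    by_cases h₃ : c₂.Rel i₂ (c₂.next i₂)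
    · rw [mapBifunctor.d₂_eq' _ _ _ _ _ h₃]
      simp [h₂]
    · exact mapBifunctor.d₂_eq_zero _ _ _ _ _ _ _ h₃
  rw [e₁, e₂, add_zero]

/-- The homology of a complex with zero differentials. -/
noncomputable def HomologicalComplex.homologyIsoXOfZeros {C I : Type*} [Category* C]
    [HasZeroMorphisms C] {c : ComplexShape I} (K : HomologicalComplex C c)
    (h : ∀ i j, K.d i j = 0) (i : I) [K.HasHomology i] : K.homology i ≅ K.X i :=
  (ShortComplex.LeftHomologyData.ofZeros (K.sc i) (h _ _) (h _ _)).homologyIso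

variable {k : Type} [Field k]

instance ModuleCat.projective_of_field (X : ModuleCat.{0} k) : Projective X :=
  (IsProjective.iff_projective X).1 (Module.Projective.of_free (R := k) (P := X))

/-- Over a field, the homology of a tensor product of complexes is the graded tensor product of
the homologies. -/
theorem nonempty_homology_tensor_iso (K L : ChainComplex (ModuleCat.{0} k) ℕ) (n : ℕ) :
    Nonempty ((mapBifunctor K L (curriedTensor (ModuleCat.{0} k)) (ComplexShape.down ℕ)).homology n
      ≃ₗ[k]
      DirectSum {pq : ℕ × ℕ // pq.1 + pq.2 = n}
        (fun pq ↦ (K.homology pq.1.1 ⊗[k] L.homology pq.1.2 : Type))) := by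
  obtain ⟨e₁⟩ := K.nonempty_homotopyEquiv_homologyComplex
  obtain ⟨e₂⟩ := L.nonempty_homotopyEquiv_homologyComplex
  let T := mapBifunctor K.homologyComplex L.homologyComplex (curriedTensor (ModuleCat.{0} k))
    (ComplexShape.down ℕ)
  have hT (i j : ℕ) : T.d i j = 0 :=
    mapBifunctor_d_eq_zero _ _ _ _ (fun _ _ ↦ rfl) (fun _ _ ↦ rfl) i j
  let i₁ := (e₁.mapBifunctor e₂ (curriedTensor (ModuleCat.{0} k))
    (ComplexShape.down ℕ)).toHomologyIso n
  let i₂ := T.homologyIsoXOfZeros hT n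
  let i₃ := IsColimit.coconePointUniqueUpToIso
    (GradedObject.isColimitCofanMapObj
      ((((curriedTensor (ModuleCat.{0} k)).mapBifunctorHomologicalComplex _ _).obj
        K.homologyComplex).obj L.homologyComplex).toGradedObject
      (ComplexShape.π (ComplexShape.down ℕ) (ComplexShape.down ℕ) (ComplexShape.down ℕ)) n)
    (ModuleCat.coproductCoconeIsColimit (R := k) (fun pq : {pq : ℕ × ℕ // pq.1 + pq.2 = n} ↦
      ModuleCat.of k (K.homology pq.1.1 ⊗[k] L.homology pq.1.2 : Type)))
  exact ⟨(i₁ ≪≫ i₂ ≪≫ i₃).toLinearEquiv⟩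

end FieldKunneth

section TensorModuleProjective

variable (k : Type) [CommRing k] (R1 R2 : Type) [CommRing R1] [CommRing R2]
  [Algebra k R1] [Algebra k R2]

/-- `(I →₀ R1) ⊗[k] (J →₀ R2)` is free over `R1 ⊗[k] R2`. -/
noncomputable def tensorModuleFinsuppEquiv (I J : Type) :
    (I →₀ R1) ⊗[k] (J →₀ R2) ≃ₗ[R1 ⊗[k] R2] (I × J →₀ R1 ⊗[k] R2) :=
  LinearEquiv.ofBijective
    (linearMapOfTmul k R1 R2 (finsuppTensorFinsupp k k R1 R2 I J).toLinearMap.toAddMonoidHom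
      (fun r1 r2 m1 m2 ↦ by
        ext ⟨i, j⟩
        simp [finsuppTensorFinsupp_apply]))
    (finsuppTensorFinsupp k k R1 R2 I J).bijective

variable (P Q : Type)
  [AddCommGroup P] [Module k P] [Module R1 P] [IsScalarTower k R1 P]
  [AddCommGroup Q] [Module k Q] [Module R2 Q] [IsScalarTower k R2 Q]

theorem tensorModule_projective [Module.Projective R1 P] [Module.Projective R2 Q] :
    Module.Projective (R1 ⊗[k] R2) (P ⊗[k] Q) := by
  obtain ⟨s, hs⟩ := Module.Projective.out (R := R1) (P := P)
  obtain ⟨t, ht⟩ := Module.Projective.out (R := R2) (P := Q)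
  have : Module.Projective (R1 ⊗[k] R2) ((P →₀ R1) ⊗[k] (Q →₀ R2)) :=
    Module.Projective.of_equiv (tensorModuleFinsuppEquiv k R1 R2 P Q).symm
  refine Module.Projective.of_split (tensorModuleMap k R1 R2 s t)
    (tensorModuleMap k R1 R2 (Finsupp.linearCombination R1 id) (Finsupp.linearCombination R2 id))
    (tensorModule_linearMap_ext (fun p q ↦ ?_))
  simp only [LinearMap.comp_apply, tensorModuleMap_tmul, LinearMap.id_apply]
  rw [hs, ht]

variable {k R1 R2 P Q}
variable {P' Q' N1 N2 : Type}
  [AddCommGroup P'] [Module k P'] [Module R1 P'] [IsScalarTower k R1 P']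
  [AddCommGroup Q'] [Module k Q'] [Module R2 Q'] [IsScalarTower k R2 Q']
  [AddCommGroup N1] [Module k N1] [Module R1 N1] [IsScalarTower k R1 N1]
  [AddCommGroup N2] [Module k N2] [Module R2 N2] [IsScalarTower k R2 N2]

theorem tensorModuleMap_surjective {f : P →ₗ[R1] N1} {g : Q →ₗ[R2] N2}
    (hf : Function.Surjective f) (hg : Function.Surjective g) :
    Function.Surjective (tensorModuleMap k R1 R2 f g) :=
  TensorProduct.map_surjective (g := f.restrictScalars k) (g' := g.restrictScalars k) hf hg

theorem exists_of_tensorModuleMap_eq_zero {f : P →ₗ[R1] N1} {g : Q →ₗ[R2] N2}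
    {f' : P' →ₗ[R1] P} {g' : Q' →ₗ[R2] Q}
    (hf : Function.Surjective f) (hg : Function.Surjective g)
    (hf' : Function.Exact f' f) (hg' : Function.Exact g' g) (x : P ⊗[k] Q)
    (hx : tensorModuleMap k R1 R2 f g x = 0) :
    ∃ (a : P' ⊗[k] Q) (b : P ⊗[k] Q'), tensorModuleMap k R1 R2 f' .id a +
      tensorModuleMap k R1 R2 .id g' b = x := by
  have h := TensorProduct.map_ker (f := f'.restrictScalars k) (g := f.restrictScalars k)
    (f' := g'.restrictScalars k) (g' := g.restrictScalars k) hf' hf hg' hg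
  have hx' : x ∈ LinearMap.ker (TensorProduct.map (f.restrictScalars k) (g.restrictScalars k)) := hx
  rw [h, Submodule.mem_sup] at hx'
  obtain ⟨_, ⟨b, rfl⟩, _, ⟨a, rfl⟩, rfl⟩ := hx'
  exact ⟨a, b, add_comm _ _⟩

end TensorModuleProjective

section TensorBifunctor

open Limits HomologicalComplex MonoidalCategory

/-- A module over a `k`-algebra, regarded as a module over `k`. -/
noncomputable instance (priority := 10) ModuleCat.scalarModule (k : Type) [CommRing k] {R : Type}
    [CommRing R] [Algebra k R] (M : ModuleCat.{0} R) : Module k M :=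
  Module.compHom M (algebraMap k R)

instance (priority := 10) ModuleCat.isScalarTower_scalarModule (k : Type) [CommRing k]
    {R : Type} [CommRing R] [Algebra k R] (M : ModuleCat.{0} R) : IsScalarTower k R M :=
  IsScalarTower.of_algebraMap_smul (fun _ _ ↦ rfl)

section

variable (k : Type) [CommRing k] (R1 R2 : Type) [CommRing R1] [CommRing R2]
  [Algebra k R1] [Algebra k R2]

/-- The tensor product over `k`, as a bifunctor from `R1`-modules and `R2`-modules to
`R1 ⊗[k] R2`-modules. -/
noncomputable def tensorBifunctor :
    ModuleCat.{0} R1 ⥤ ModuleCat.{0} R2 ⥤ ModuleCat.{0} (R1 ⊗[k] R2) where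
  obj M1 :=
    { obj M2 := ModuleCat.of (R1 ⊗[k] R2) (M1 ⊗[k] M2)
      map g := ModuleCat.ofHom (tensorModuleMap k R1 R2 .id g.hom)
      map_id _ := ModuleCat.hom_ext (tensorModule_linearMap_ext (fun _ _ ↦ rfl))
      map_comp _ _ := ModuleCat.hom_ext (tensorModule_linearMap_ext (fun _ _ ↦ rfl)) }
  map f :=
    { app _ := ModuleCat.ofHom (tensorModuleMap k R1 R2 f.hom .id)
      naturality _ _ _ := ModuleCat.hom_ext (tensorModule_linearMap_ext (fun _ _ ↦ rfl)) }
  map_id _ := NatTrans.ext (funext fun _ ↦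
    ModuleCat.hom_ext (tensorModule_linearMap_ext (fun _ _ ↦ rfl)))
  map_comp _ _ := NatTrans.ext (funext fun _ ↦
    ModuleCat.hom_ext (tensorModule_linearMap_ext (fun _ _ ↦ rfl)))

instance : (tensorBifunctor k R1 R2).Additive where
  map_add := NatTrans.ext (funext fun _ ↦
    ModuleCat.hom_ext (tensorModule_linearMap_ext (fun _ _ ↦ TensorProduct.add_tmul _ _ _)))

instance (M1 : ModuleCat.{0} R1) : ((tensorBifunctor k R1 R2).obj M1).Additive where
  map_add :=
    ModuleCat.hom_ext (tensorModule_linearMap_ext (fun _ _ ↦ TensorProduct.tmul_add _ _ _))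

variable {k R1 R2} in
lemma algebraMap_smul_tensorModule {M1 M2 : Type} [AddCommGroup M1] [Module k M1] [Module R1 M1]
    [IsScalarTower k R1 M1] [AddCommGroup M2] [Module k M2] [Module R2 M2] [IsScalarTower k R2 M2]
    (c : k) (x : M1 ⊗[k] M2) :
    algebraMap k (R1 ⊗[k] R2) c • x = c • x := by
  induction x using TensorProduct.induction_on with
  | zero => simp
  | add x y hx hy => rw [smul_add, hx, hy, smul_add]
  | tmul m1 m2 =>
    rw [Algebra.TensorProduct.algebraMap_apply, tensorModule_smul_tmul, one_smul, algebraMap_smul,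
      TensorProduct.smul_tmul']

/-- The two `k`-module structures on `M1 ⊗[k] M2` agree. -/
noncomputable def tensorModuleRestrictScalarsEquiv (M1 : ModuleCat.{0} R1) (M2 : ModuleCat.{0} R2) :
    (M1 ⊗[k] M2 : Type) ≃ₗ[k] (ModuleCat.restrictScalars (algebraMap k (R1 ⊗[k] R2))).obj
      (((tensorBifunctor k R1 R2).obj M1).obj M2) :=
  { AddEquiv.refl (M1 ⊗[k] M2 : Type) with
    map_smul' c x := (algebraMap_smul_tensorModule c x).symm }

/-- The tensor product of the underlying `k`-modules is the `k`-module underlying the tensor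
product. -/
noncomputable def tensorBifunctorRestrictScalarsIso (M1 : ModuleCat.{0} R1)
    (M2 : ModuleCat.{0} R2) :
    ((curriedTensor (ModuleCat.{0} k)).obj
        ((ModuleCat.restrictScalars (algebraMap k R1)).obj M1)).obj
      ((ModuleCat.restrictScalars (algebraMap k R2)).obj M2) ≅
    (ModuleCat.restrictScalars (algebraMap k (R1 ⊗[k] R2))).obj
      (((tensorBifunctor k R1 R2).obj M1).obj M2) :=
  (tensorModuleRestrictScalarsEquiv k R1 R2 M1 M2).toModuleIso

end

variable (k : Type) [Field k] (R1 R2 : Type) [CommRing R1] [CommRing R2]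
  [Algebra k R1] [Algebra k R2]

theorem nonempty_homology_tensorBifunctor_equiv (K : ChainComplex (ModuleCat.{0} R1) ℕ)
    (L : ChainComplex (ModuleCat.{0} R2) ℕ) (n : ℕ) :
    Nonempty (((mapBifunctor K L (tensorBifunctor k R1 R2) (ComplexShape.down ℕ)).homology n) ≃ₗ[k]
      DirectSum {pq : ℕ × ℕ // pq.1 + pq.2 = n}
        (fun pq ↦ (K.homology pq.1.1 ⊗[k] L.homology pq.1.2 : Type))) := by
  let G := ModuleCat.restrictScalars.{0} (algebraMap k (R1 ⊗[k] R2))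
  let G₁ := ModuleCat.restrictScalars.{0} (algebraMap k R1)
  let G₂ := ModuleCat.restrictScalars.{0} (algebraMap k R2)
  let K' := (G₁.mapHomologicalComplex _).obj K
  let L' := (G₂.mapHomologicalComplex _).obj L
  obtain ⟨e⟩ := nonempty_homology_tensor_iso K' L' n
  let T := mapBifunctor K L (tensorBifunctor k R1 R2) (ComplexShape.down ℕ)
  let i := mapBifunctorMapIso K L (tensorBifunctor k R1 R2) K' L' (curriedTensor (ModuleCat.{0} k))
    (ComplexShape.down ℕ) G
    (fun i j ↦ tensorBifunctorRestrictScalarsIso k R1 R2 (K.X i) (L.X j))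
    (fun _ _ _ ↦ ModuleCat.hom_ext (TensorProduct.ext' fun _ _ ↦ rfl))
    (fun _ _ _ ↦ ModuleCat.hom_ext (TensorProduct.ext' fun _ _ ↦ rfl))
  let e₁ : ((G.mapHomologicalComplex _).obj T).homology n ≅ G.obj (T.homology n) :=
    (T.sc n).mapHomologyIso G
  let e₂ (p : ℕ) : K'.homology p ≅ G₁.obj (K.homology p) := (K.sc p).mapHomologyIso G₁
  let e₃ (p : ℕ) : L'.homology p ≅ G₂.obj (L.homology p) := (L.sc p).mapHomologyIso G₂
  let e₄ : T.homology n ≃ₗ[k] G.obj (T.homology n) := LinearEquiv.refl _ _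
  refine ⟨e₄ ≪≫ₗ e₁.symm.toLinearEquiv ≪≫ₗ
    ((homologyFunctor _ _ n).mapIso i).symm.toLinearEquiv ≪≫ₗ e ≪≫ₗ ?_⟩
  exact DFinsupp.mapRange.linearEquiv (fun pq ↦
    TensorProduct.congr (e₂ pq.1.1).toLinearEquiv (e₃ pq.1.2).toLinearEquiv)

end TensorBifunctor

/-- A chain complex of projective objects which is exact in positive degrees, with an exact
augmentation, gives a projective resolution. -/
noncomputable def ProjectiveResolution.ofExact {C : Type*} [Category* C] [Abelian C] {Z : C}
    (K : ChainComplex C ℕ) (hP : ∀ n, Projective (K.X n)) (a : K.X 0 ⟶ Z) (w : K.d 1 0 ≫ a = 0)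
    (ha : Epi a) (h₀ : (ShortComplex.mk _ _ w).Exact) (h : ∀ n, K.ExactAt (n + 1)) :
    ProjectiveResolution Z where
  complex := K
  projective := hP
  π := (ChainComplex.toSingle₀Equiv _ _).symm ⟨a, w⟩
  quasiIso := ⟨fun n => by
    cases n
    · rw [ChainComplex.quasiIsoAt₀_iff, ShortComplex.quasiIso_iff_of_zeros']
      · have hπ : ((ChainComplex.toSingle₀Equiv K Z).symm ⟨a, w⟩).f 0 = a :=
          ChainComplex.toSingle₀Equiv_symm_apply_f_zero a w
        refine (ShortComplex.exact_and_epi_g_iff_of_iso ?_).2 ⟨h₀, ha⟩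
        exact ShortComplex.isoMk (Iso.refl _) (Iso.refl _) (Iso.refl _)
          ((Category.id_comp _).trans (Category.comp_id _).symm)
          ((Category.id_comp _).trans (hπ.symm.trans (Category.comp_id _).symm))
      · exact K.shape _ _ (by simp)
      all_goals rfl
    · rw [quasiIsoAt_iff_exactAt']
      · apply h
      · apply ChainComplex.exactAt_succ_single_obj⟩

section TensorResolution

open Limits HomologicalComplex MonoidalCategory

variable (k : Type) [Field k] (R1 R2 : Type) [CommRing R1] [CommRing R2]
  [Algebra k R1] [Algebra k R2]

instance (P : ModuleCat.{0} R1) (Q : ModuleCat.{0} R2) [Projective P] [Projective Q] :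
    Projective (((tensorBifunctor k R1 R2).obj P).obj Q) := by
  have := (IsProjective.iff_projective P).2 ‹_›
  have := (IsProjective.iff_projective Q).2 ‹_›
  have := tensorModule_projective k R1 R2 P Q
  exact (IsProjective.iff_projective _).1 this

theorem projective_mapBifunctor_X {C₁ C₂ D I₁ I₂ J : Type*} [Category* C₁]
    [Category* C₂] [Category* D] [Preadditive C₁] [Preadditive C₂] [Preadditive D]
    {c₁ : ComplexShape I₁} {c₂ : ComplexShape I₂}
    (K₁ : HomologicalComplex C₁ c₁) (K₂ : HomologicalComplex C₂ c₂)
    (F : C₁ ⥤ C₂ ⥤ D) [F.Additive] [∀ X₁, (F.obj X₁).Additive]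
    (c : ComplexShape J) [DecidableEq J] [TotalComplexShape c₁ c₂ c]
    [HasMapBifunctor K₁ K₂ F c] (h : ∀ i j, Projective ((F.obj (K₁.X i)).obj (K₂.X j))) (n : J) :
    Projective ((mapBifunctor K₁ K₂ F c).X n) where
  factors {E X} f e _ := by
    have := h
    refine ⟨mapBifunctorDesc (fun i j hij ↦
      Projective.factorThru (ιMapBifunctor K₁ K₂ F c i j n hij ≫ f) e), ?_⟩
    apply mapBifunctor.hom_ext
    intro i j hij
    rw [ι_mapBifunctorDesc_assoc, Projective.factorThru_comp]

section Augmentation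

variable {C₁ C₂ D : Type*} [Category* C₁]
    [Category* C₂] [Category* D] [Preadditive C₁] [Preadditive C₂] [Preadditive D]
    (K₁ : ChainComplex C₁ ℕ) (K₂ : ChainComplex C₂ ℕ)
    (F : C₁ ⥤ C₂ ⥤ D) [F.Additive] [∀ X₁, (F.obj X₁).Additive]
    [HasMapBifunctor K₁ K₂ F (ComplexShape.down ℕ)]

/-- The degree zero term of a first quadrant total complex. -/
noncomputable def mapBifunctorXZeroIso : (F.obj (K₁.X 0)).obj (K₂.X 0) ≅
    (mapBifunctor K₁ K₂ F (ComplexShape.down ℕ)).X 0 where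
  hom := ιMapBifunctor K₁ K₂ F (ComplexShape.down ℕ) 0 0 0 rfl
  inv := mapBifunctorDesc (fun i j h ↦ match i, j, h with
    | 0, 0, _ => 𝟙 _
    | (i + 1), j, h => 0
    | 0, (j + 1), h => 0)
  hom_inv_id := by rw [ι_mapBifunctorDesc]
  inv_hom_id := by
    apply mapBifunctor.hom_ext
    intro i j h
    have h' : i + j = 0 := h
    obtain ⟨rfl, rfl⟩ : i = 0 ∧ j = 0 := by omega
    rw [ι_mapBifunctorDesc_assoc, Category.id_comp, Category.comp_id]

lemma ι_one_zero_comp_d : ιMapBifunctor K₁ K₂ F (ComplexShape.down ℕ) 1 0 1 rfl ≫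
    (mapBifunctor K₁ K₂ F (ComplexShape.down ℕ)).d 1 0 =
      (F.map (K₁.d 1 0)).app (K₂.X 0) ≫ ιMapBifunctor K₁ K₂ F (ComplexShape.down ℕ) 0 0 0 rfl := by
  rw [mapBifunctor.d_eq, Preadditive.comp_add, mapBifunctor.ι_D₁, mapBifunctor.ι_D₂,
    mapBifunctor.d₁_eq K₁ K₂ F (ComplexShape.down ℕ) (show (ComplexShape.down ℕ).Rel 1 0 from rfl)
      0 0 rfl,
    mapBifunctor.d₂_eq_zero _ _ _ _ _ _ _ (by simp), add_zero]
  exact one_smul _ _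

lemma ι_zero_one_comp_d : ιMapBifunctor K₁ K₂ F (ComplexShape.down ℕ) 0 1 1 rfl ≫
    (mapBifunctor K₁ K₂ F (ComplexShape.down ℕ)).d 1 0 =
      (F.obj (K₁.X 0)).map (K₂.d 1 0) ≫ ιMapBifunctor K₁ K₂ F (ComplexShape.down ℕ) 0 0 0 rfl := by
  rw [mapBifunctor.d_eq, Preadditive.comp_add, mapBifunctor.ι_D₁, mapBifunctor.ι_D₂,
    mapBifunctor.d₂_eq K₁ K₂ F (ComplexShape.down ℕ) 0
      (show (ComplexShape.down ℕ).Rel 1 0 from rfl) 0 rfl,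
    mapBifunctor.d₁_eq_zero _ _ _ _ _ _ _ (by simp), zero_add]
  exact one_smul _ _

end Augmentation

/-- The tensor product over `k` of projective resolutions over `R1` and `R2`, as a projective
resolution over `R1 ⊗[k] R2`. -/
noncomputable def tensorResolution {N1 : ModuleCat.{0} R1} {N2 : ModuleCat.{0} R2}
    (P : ProjectiveResolution N1) (Q : ProjectiveResolution N2) :
    ProjectiveResolution (((tensorBifunctor k R1 R2).obj N1).obj N2) := by
  let F := tensorBifunctor k R1 R2
  let T := mapBifunctor P.complex Q.complex F (ComplexShape.down ℕ)
  let a : P.complex.X 0 ⟶ N1 := P.π.f 0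
  let b : Q.complex.X 0 ⟶ N2 := Q.π.f 0
  have ha : P.complex.d 1 0 ≫ a = 0 := P.complex_d_comp_π_f_zero
  have hb : Q.complex.d 1 0 ≫ b = 0 := Q.complex_d_comp_π_f_zero
  have ha' : Epi a := inferInstanceAs (Epi (P.π.f 0))
  have hb' : Epi b := inferInstanceAs (Epi (Q.π.f 0))
  have ha'' : (ShortComplex.mk _ _ ha).Exact := P.exact₀
  have hb'' : (ShortComplex.mk _ _ hb).Exact := Q.exact₀
  let ab : (F.obj (P.complex.X 0)).obj (Q.complex.X 0) ⟶ (F.obj N1).obj N2 :=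
    ModuleCat.ofHom (tensorModuleMap k R1 R2 a.hom b.hom)
  let ι := mapBifunctorXZeroIso P.complex Q.complex F
  have w : T.d 1 0 ≫ ι.inv ≫ ab = 0 := by
    apply mapBifunctor.hom_ext
    intro i j h
    have h' : i + j = 1 := h
    obtain ⟨rfl, rfl⟩ | ⟨rfl, rfl⟩ : (i = 1 ∧ j = 0) ∨ (i = 0 ∧ j = 1) := by omega
    · rw [reassoc_of% (ι_one_zero_comp_d P.complex Q.complex F)]
      change _ ≫ ι.hom ≫ ι.inv ≫ ab = _
      rw [ι.hom_inv_id_assoc, comp_zero]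
      refine ModuleCat.hom_ext (tensorModule_linearMap_ext (fun x y ↦ ?_))
      change (P.complex.d 1 0 ≫ a) x ⊗ₜ[k] b y = 0
      rw [ha]
      exact TensorProduct.zero_tmul _ _
    · rw [reassoc_of% (ι_zero_one_comp_d P.complex Q.complex F)]
      change _ ≫ ι.hom ≫ ι.inv ≫ ab = _
      rw [ι.hom_inv_id_assoc, comp_zero]
      refine ModuleCat.hom_ext (tensorModule_linearMap_ext (fun x y ↦ ?_))
      change a x ⊗ₜ[k] (Q.complex.d 1 0 ≫ b) y = 0
      rw [hb]
      exact TensorProduct.tmul_zero _ _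
  refine ProjectiveResolution.ofExact T
    (fun n ↦ projective_mapBifunctor_X _ _ _ _ (fun _ _ ↦ inferInstance) n) (ι.inv ≫ ab) w ?_ ?_ ?_
  · have : Epi ab := (ModuleCat.epi_iff_surjective _).2 (tensorModuleMap_surjective
      ((ModuleCat.epi_iff_surjective a).1 ha') ((ModuleCat.epi_iff_surjective b).1 hb'))
    infer_instance
  · rw [ShortComplex.moduleCat_exact_iff]
    intro x hx
    obtain ⟨u, v, huv⟩ := exists_of_tensorModuleMap_eq_zero
      ((ModuleCat.epi_iff_surjective a).1 ha') ((ModuleCat.epi_iff_surjective b).1 hb')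
      ((ShortComplex.ShortExact.moduleCat_exact_iff_function_exact _).1 ha'')
      ((ShortComplex.ShortExact.moduleCat_exact_iff_function_exact _).1 hb'') (ι.inv x) hx
    refine ⟨ιMapBifunctor P.complex Q.complex F (ComplexShape.down ℕ) 1 0 1 rfl u +
      ιMapBifunctor P.complex Q.complex F (ComplexShape.down ℕ) 0 1 1 rfl v, ?_⟩
    have hu := congr($(ι_one_zero_comp_d P.complex Q.complex F) u)
    have hv := congr($(ι_zero_one_comp_d P.complex Q.complex F) v)
    have hx' : ι.hom (ι.inv x) = x := congr($(ι.inv_hom_id) x)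
    refine (map_add (T.d 1 0).hom _ _).trans (Eq.trans ?_ hx')
    refine Eq.trans ?_ (congrArg ι.hom.hom huv)
    exact (congrArg₂ (· + ·) hu hv).trans (map_add ι.hom.hom _ _).symm
  · intro n
    rw [exactAt_iff_isZero_homology]
    obtain ⟨e⟩ := nonempty_homology_tensorBifunctor_equiv k R1 R2 P.complex Q.complex (n + 1)
    have (pq : {pq : ℕ × ℕ // pq.1 + pq.2 = n + 1}) :
        Subsingleton (P.complex.homology pq.1.1 ⊗[k] Q.complex.homology pq.1.2 : Type) := by
      obtain ⟨⟨_ | p, _ | q⟩, h⟩ := pq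
      · simp at h
      · have := ModuleCat.subsingleton_of_isZero
          ((exactAt_iff_isZero_homology _ _).1 (Q.complex_exactAt_succ q))
        infer_instance
      · have := ModuleCat.subsingleton_of_isZero
          ((exactAt_iff_isZero_homology _ _).1 (P.complex_exactAt_succ p))
        infer_instance
      · have := ModuleCat.subsingleton_of_isZero
          ((exactAt_iff_isZero_homology _ _).1 (P.complex_exactAt_succ p))
        infer_instance
    have := e.injective.subsingleton
    exact ModuleCat.isZero_of_subsingleton _

end TensorResolution

section TensorTor

open Limits HomologicalComplex MonoidalCategory

variable (k : Type) [Field k] (R1 R2 : Type) [CommRing R1] [CommRing R2]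
  [Algebra k R1] [Algebra k R2]

/-- The isomorphism `(M1 ⊗[k] M2) ⊗[R1 ⊗[k] R2] (P ⊗[k] Q) ≅ (M1 ⊗[R1] P) ⊗[k] (M2 ⊗[R2] Q)` in
the category of modules over `R1 ⊗[k] R2`. -/
noncomputable def tensorBifunctorTensorIso (M1 P : ModuleCat.{0} R1) (M2 Q : ModuleCat.{0} R2) :
    ((tensorBifunctor k R1 R2).obj (M1 ⊗ P)).obj (M2 ⊗ Q) ≅
      ((tensorBifunctor k R1 R2).obj M1).obj M2 ⊗ ((tensorBifunctor k R1 R2).obj P).obj Q :=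
  (tensorDistrib k R1 R2 (M1 := M1) (M2 := M2) (P := P) (Q := Q) (T1 := (M1 ⊗ P : ModuleCat R1))
    (T2 := (M2 ⊗ Q : ModuleCat R2)) (LinearEquiv.refl R1 (TensorProduct R1 M1 P))
    (LinearEquiv.refl R2 (TensorProduct R2 M2 Q))).symm.toModuleIso

lemma tensorBifunctorTensorIso_inv_naturality_left {M1 P P' : ModuleCat.{0} R1}
    {M2 Q : ModuleCat.{0} R2} (f : P ⟶ P') :
    (tensorBifunctorTensorIso k R1 R2 M1 P M2 Q).inv ≫
      ((tensorBifunctor k R1 R2).map (M1 ◁ f)).app (M2 ⊗ Q) =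
    (((tensorBifunctor k R1 R2).obj M1).obj M2 ◁ ((tensorBifunctor k R1 R2).map f).app Q) ≫
      (tensorBifunctorTensorIso k R1 R2 M1 P' M2 Q).inv :=
  ModuleCat.hom_ext (TensorProduct.ext (tensorModule_linearMap_ext (fun _ _ ↦
    tensorModule_linearMap_ext (fun _ _ ↦ rfl))))

lemma tensorBifunctorTensorIso_inv_naturality_right {M1 P : ModuleCat.{0} R1}
    {M2 Q Q' : ModuleCat.{0} R2} (g : Q ⟶ Q') :
    (tensorBifunctorTensorIso k R1 R2 M1 P M2 Q).inv ≫
      ((tensorBifunctor k R1 R2).obj (M1 ⊗ P)).map (M2 ◁ g) =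
    (((tensorBifunctor k R1 R2).obj M1).obj M2 ◁ ((tensorBifunctor k R1 R2).obj P).map g) ≫
      (tensorBifunctorTensorIso k R1 R2 M1 P M2 Q').inv :=
  ModuleCat.hom_ext (TensorProduct.ext (tensorModule_linearMap_ext (fun _ _ ↦
    tensorModule_linearMap_ext (fun _ _ ↦ rfl))))

/-- An `R`-linear isomorphism is `k`-linear for every `k`-algebra `R`. -/
noncomputable def CategoryTheory.Iso.toScalarLinearEquiv {R : Type} [CommRing R] [Algebra k R]
    {M N : ModuleCat.{0} R} (e : M ≅ N) : M ≃ₗ[k] N :=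
  e.toLinearEquiv.restrictScalars k

/-- Restriction of scalars along `k → R` in terms of `ModuleCat.scalarModule`. -/
noncomputable def ModuleCat.restrictScalarsScalarEquiv {R : Type} [CommRing R] [Algebra k R]
    (M : ModuleCat.{0} R) : RestrictScalars k R M ≃ₗ[k] M :=
  { RestrictScalars.addEquiv k R M with
    map_smul' _ _ := rfl }

theorem nonempty_tor_tensorBifunctor_equiv (M1 N1 : ModuleCat.{0} R1) (M2 N2 : ModuleCat.{0} R2)
    (n : ℕ) :
    Nonempty (RestrictScalars k (R1 ⊗[k] R2)
        (((Tor _ n).obj (((tensorBifunctor k R1 R2).obj M1).obj M2)).obj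
          (((tensorBifunctor k R1 R2).obj N1).obj N2)) ≃ₗ[k]
      DirectSum {pq : ℕ × ℕ // pq.1 + pq.2 = n} (fun pq ↦
        RestrictScalars k R1 (((Tor _ pq.1.1).obj M1).obj N1) ⊗[k]
          RestrictScalars k R2 (((Tor _ pq.1.2).obj M2).obj N2))) := by
  let F := tensorBifunctor k R1 R2
  let P := projectiveResolution N1
  let Q := projectiveResolution N2
  let G := (tensoringLeft (ModuleCat.{0} (R1 ⊗[k] R2))).obj ((F.obj M1).obj M2)
  let G₁ := (tensoringLeft (ModuleCat.{0} R1)).obj M1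
  let G₂ := (tensoringLeft (ModuleCat.{0} R2)).obj M2
  let K := (G₁.mapHomologicalComplex (ComplexShape.down ℕ)).obj P.complex
  let L := (G₂.mapHomologicalComplex (ComplexShape.down ℕ)).obj Q.complex
  let i := mapBifunctorMapIso P.complex Q.complex F K L F (ComplexShape.down ℕ) G
    (fun i j ↦ tensorBifunctorTensorIso k R1 R2 M1 (P.complex.X i) M2 (Q.complex.X j))
    (fun _ _ _ ↦ ((Iso.inv_comp_eq _).1 ((Category.assoc _ _ _).symm.trans
      ((Iso.comp_inv_eq _).1 (tensorBifunctorTensorIso_inv_naturality_left k R1 R2 _).symm).symm)))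
    (fun _ _ _ ↦ ((Iso.inv_comp_eq _).1 ((Category.assoc _ _ _).symm.trans
      ((Iso.comp_inv_eq _).1 (tensorBifunctorTensorIso_inv_naturality_right k R1 R2 _).symm).symm)))
  obtain ⟨e⟩ := nonempty_homology_tensorBifunctor_equiv k R1 R2 K L n
  refine ⟨ModuleCat.restrictScalarsScalarEquiv k _ ≪≫ₗ
    ((tensorResolution k R1 R2 P Q).isoLeftDerivedObj G n).toScalarLinearEquiv k ≪≫ₗ
    ((homologyFunctor _ _ n).mapIso i).symm.toScalarLinearEquiv k ≪≫ₗ e ≪≫ₗ ?_⟩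
  exact DFinsupp.mapRange.linearEquiv (fun pq ↦ TensorProduct.congr
    ((P.isoLeftDerivedObj G₁ pq.1.1).symm.toScalarLinearEquiv k ≪≫ₗ
      (ModuleCat.restrictScalarsScalarEquiv k _).symm)
    ((Q.isoLeftDerivedObj G₂ pq.1.2).symm.toScalarLinearEquiv k ≪≫ₗ
      (ModuleCat.restrictScalarsScalarEquiv k _).symm))

end TensorTor

lemma Module.eq_compHom_of_isScalarTower (k R M : Type*) [CommRing k] [CommRing R] [Algebra k R]
    [AddCommGroup M] [m : Module k M] [Module R M] [IsScalarTower k R M] :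
    m = Module.compHom M (algebraMap k R) :=
  Module.ext' _ _ (fun r x ↦ (algebraMap_smul R r x).symm)

open TensorProduct DirectSum in
/-- Let `k` be a field, `R1`, `R2` commutative `k`-algebras, `M1, N1` modules over `R1`
and `M2, N2` modules over `R2`.  For every `n ≥ 0` there is an isomorphism of
`k`-vector spaces
`Tor_n^{R1 ⊗ R2}(M1 ⊗ M2, N1 ⊗ N2) ≅ ⊕_{p+q=n} Tor_p^{R1}(M1,N1) ⊗ Tor_q^{R2}(M2,N2)`. -/
theorem tor_tensorProduct_kunneth
    (k : Type) [Field k] (R1 R2 : Type) [CommRing R1] [CommRing R2]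
    [Algebra k R1] [Algebra k R2]
    (M1 N1 : Type) [AddCommGroup M1] [Module k M1] [Module R1 M1] [IsScalarTower k R1 M1]
    [AddCommGroup N1] [Module k N1] [Module R1 N1] [IsScalarTower k R1 N1]
    (M2 N2 : Type) [AddCommGroup M2] [Module k M2] [Module R2 M2] [IsScalarTower k R2 M2]
    [AddCommGroup N2] [Module k N2] [Module R2 N2] [IsScalarTower k R2 N2]
    (n : ℕ) :
    Nonempty (
      (RestrictScalars k (R1 ⊗[k] R2)
          (torGroup (R1 ⊗[k] R2) (M1 ⊗[k] M2) (N1 ⊗[k] N2) n)) ≃ₗ[k]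
        (⨁ pq : {pq : ℕ × ℕ // pq.1 + pq.2 = n},
          (RestrictScalars k R1 (torGroup R1 M1 N1 pq.1.1)) ⊗[k]
            (RestrictScalars k R2 (torGroup R2 M2 N2 pq.1.2)))) := by
  obtain rfl := Module.eq_compHom_of_isScalarTower k R1 M1
  obtain rfl := Module.eq_compHom_of_isScalarTower k R1 N1
  obtain rfl := Module.eq_compHom_of_isScalarTower k R2 M2
  obtain rfl := Module.eq_compHom_of_isScalarTower k R2 N2
  exact nonempty_tor_tensorBifunctor_equiv k R1 R2 (ModuleCat.of R1 M1) (ModuleCat.of R1 N1)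
    (ModuleCat.of R2 M2) (ModuleCat.of R2 N2) n
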